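/- Let α > 0 and Γ > 0. For every x > 0 one has 0 < l(x) < 1/3, where l(x) = α p(x)/(α + √Γ g(x)). -/

import Mathlib

lemma pos_of_deriv_pos_aux (f f' : ℝ → ℝ) (h0 : f 0 = 0) (hd : ∀ x, HasDerivAt f (f' x) x)
    (hpos : ∀ x, 0 < x → 0 < f' x) (x : ℝ) (hx : 0 < x) : 0 < f x := by
  have hm : StrictMonoOn f (Set.Ici 0) := by
    apply strictMonoOn_of_deriv_pos (convex_Ici 0)
    · exact fun y _ => (hd y).continuousAt.continuousWithinAt
    · intro y hy
      rw [interior_Ici] at hy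
      rw [(hd y).deriv]
      exact hpos y hy
  have := hm (Set.mem_Ici.2 le_rfl) (Set.mem_Ici.2 hx.le) hx
  rwa [h0] at this

lemma auxA (x : ℝ) (hx : 0 < x) : 0 < x * Real.cosh x - Real.sinh x := by
  refine pos_of_deriv_pos_aux (fun x => x * Real.cosh x - Real.sinh x)
    (fun x => x * Real.sinh x) (by simp) (fun y => ?_)
    (fun y hy => mul_pos hy (Real.sinh_pos_iff.2 hy)) x hx
  have := ((hasDerivAt_id y).mul (Real.hasDerivAt_cosh y)).sub (Real.hasDerivAt_sinh y)
  refine HasDerivAt.congr_deriv this ?_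
  simp

lemma auxB (x : ℝ) (hx : 0 < x) : 0 < (x ^ 2 + 3) * Real.sinh x - 3 * (x * Real.cosh x) := by
  refine pos_of_deriv_pos_aux (fun x => (x ^ 2 + 3) * Real.sinh x - 3 * (x * Real.cosh x))
    (fun x => x * (x * Real.cosh x - Real.sinh x)) (by simp) (fun y => ?_)
    (fun y hy => mul_pos hy (auxA y hy)) x hx
  have := ((((hasDerivAt_id y).pow 2).add_const 3).mul (Real.hasDerivAt_sinh y)).sub
    (((hasDerivAt_id y).mul (Real.hasDerivAt_cosh y)).const_mul 3)
  refine HasDerivAt.congr_deriv this ?_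
  simp
  ring

/-- Let `α > 0`, `Γ > 0`. For every `x > 0` one has `0 < l(x) < 1/3`, where
`l(x) = α p(x)/(α + √Γ g(x))`. -/
theorem l_range (α Γ : ℝ) (hα : 0 < α) (hΓ : 0 < Γ)
    (g p l : ℝ → ℝ)
    (hg : ∀ x, g x = Real.cosh x / Real.sinh x - 1 / x)
    (hp : ∀ x, p x = (x * (Real.cosh x / Real.sinh x) - 1) / x ^ 2)
    (hl : ∀ x, l x = α * p x / (α + Real.sqrt Γ * g x)) :
    ∀ x : ℝ, 0 < x → 0 < l x ∧ l x < 1 / 3 := by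
  intro x hx
  have hs : 0 < Real.sinh x := Real.sinh_pos_iff.2 hx
  have hA := auxA x hx
  have hB := auxB x hx
  have hgx : 0 < g x := by
    have : g x = (x * Real.cosh x - Real.sinh x) / (x * Real.sinh x) := by
      rw [hg]; field_simp
    rw [this]; positivity
  have hpe : p x = (x * Real.cosh x - Real.sinh x) / (x ^ 2 * Real.sinh x) := by
    rw [hp]; field_simp
  have hpx : 0 < p x := by
    rw [hpe]; positivity
  have hp3 : p x < 1 / 3 := by
    rw [hpe, div_lt_div_iff₀ (by positivity) (by norm_num)]
    linarith
  have hG : 0 < Real.sqrt Γ * g x := mul_pos (Real.sqrt_pos.2 hΓ) hgx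
  rw [hl]
  refine ⟨by positivity, ?_⟩
  rw [div_lt_iff₀ (by positivity)]
  nlinarith
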